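/- (Theorem 2.1) If the coefficient systems (P,Q,R,S) on U and (P̃,Q̃,R̃,S̃) on Ũ are related by the point-transformation rule via φ, then F⁵ is pseudoscalar of weight 5: at every point of U, F⁵ = (det T)⁵·(F̃⁵∘φ). In particular the explicit formula (2.2) defines in arbitrary coordinates the pseudoscalar field F of weight 1. -/

import Mathlib

noncomputable section

open Real

/-- Partial derivative in the first argument (`f_{1.0}`). -/
def pdx (f : ℝ → ℝ → ℝ) : ℝ → ℝ → ℝ := fun x y => deriv (fun t => f t y) x

/-- Partial derivative in the second argument (`f_{0.1}`). -/
def pdy (f : ℝ → ℝ → ℝ) : ℝ → ℝ → ℝ := fun x y => deriv (fun t => f x t) y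

/-- Indexed partial derivative: `0 ↦ ∂/∂x`, `1 ↦ ∂/∂y`. -/
def pd (i : Fin 2) (f : ℝ → ℝ → ℝ) : ℝ → ℝ → ℝ := if i = 0 then pdx f else pdy f

/-- Smoothness of a two-variable real function on a set `U ⊆ ℝ²`. -/
def Smooth2 (U : Set (ℝ × ℝ)) (f : ℝ → ℝ → ℝ) : Prop :=
  ContDiffOn ℝ (⊤ : ℕ∞) (Function.uncurry f) U

/-- The quantity `A` of formula (1.6). -/
def coefA (P Q R S : ℝ → ℝ → ℝ) : ℝ → ℝ → ℝ := fun x y =>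
  pdy (pdy P) x y - 2 * pdx (pdy Q) x y + pdx (pdx R) x y
    + 2 * P x y * pdx S x y + S x y * pdx P x y
    - 3 * P x y * pdy R x y - 3 * R x y * pdy P x y
    - 3 * Q x y * pdx R x y + 6 * Q x y * pdy Q x y

/-- The quantity `B` of formula (1.6). -/
def coefB (P Q R S : ℝ → ℝ → ℝ) : ℝ → ℝ → ℝ := fun x y =>
  pdx (pdx S) x y - 2 * pdx (pdy R) x y + pdy (pdy Q) x y
    - 2 * S x y * pdy P x y - P x y * pdy S x y
    + 3 * S x y * pdx Q x y + 3 * Q x y * pdx S x y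
    + 3 * R x y * pdy Q x y - 6 * R x y * pdx R x y

/-- The quantity `G` of formula (2.4). -/
def coefG (P Q R S : ℝ → ℝ → ℝ) : ℝ → ℝ → ℝ := fun x y =>
  -(coefB P Q R S x y) * pdx (coefB P Q R S) x y
    - 3 * coefA P Q R S x y * pdy (coefB P Q R S) x y
    + 4 * coefB P Q R S x y * pdy (coefA P Q R S) x y
    + 3 * S x y * (coefA P Q R S x y)^2
    - 6 * R x y * coefA P Q R S x y * coefB P Q R S x y
    + 3 * Q x y * (coefB P Q R S x y)^2

/-- The quantity `H` of formula (2.4). -/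
def coefH (P Q R S : ℝ → ℝ → ℝ) : ℝ → ℝ → ℝ := fun x y =>
  -(coefA P Q R S x y) * pdy (coefA P Q R S) x y
    - 3 * coefB P Q R S x y * pdx (coefA P Q R S) x y
    + 4 * coefA P Q R S x y * pdx (coefB P Q R S) x y
    - 3 * P x y * (coefB P Q R S x y)^2
    + 6 * Q x y * coefA P Q R S x y * coefB P Q R S x y
    - 3 * R x y * (coefA P Q R S x y)^2

/-- The quantity `F⁵` of formula (2.2). -/
def coefF5 (P Q R S : ℝ → ℝ → ℝ) : ℝ → ℝ → ℝ := fun x y =>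
  coefA P Q R S x y * coefB P Q R S x y * pdy (coefA P Q R S) x y
    + coefA P Q R S x y * coefB P Q R S x y * pdx (coefB P Q R S) x y
    - (coefA P Q R S x y)^2 * pdy (coefB P Q R S) x y
    - (coefB P Q R S x y)^2 * pdx (coefA P Q R S) x y
    - P x y * (coefB P Q R S x y)^3
    + 3 * Q x y * coefA P Q R S x y * (coefB P Q R S x y)^2
    - 3 * R x y * (coefA P Q R S x y)^2 * coefB P Q R S x y
    + S x y * (coefA P Q R S x y)^3

/-- The fully covariant symbol `θ_{ijk}` of (2.7) built from the ODE coefficients. -/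
def thetaLow (P Q R S : ℝ → ℝ → ℝ) (i j k : Fin 2) : ℝ → ℝ → ℝ :=
  match i.1 + j.1 + k.1 with
  | 0 => P
  | 1 => Q
  | 2 => R
  | _ => S

/-- The symbol `θ^k_{ij}` of (2.8), obtained by raising the first index with `d^{kr}`. -/
def thetaUp (P Q R S : ℝ → ℝ → ℝ) (k i j : Fin 2) : ℝ → ℝ → ℝ :=
  if k = 0 then thetaLow P Q R S 1 i j
  else fun x y => -(thetaLow P Q R S 0 i j x y)

/-- Jacobian matrix entry `T^p_i = ∂x̃^p/∂x^i` of the point transformation `φ = (xt, yt)`. -/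
def Jmat (xt yt : ℝ → ℝ → ℝ) (p i : Fin 2) : ℝ → ℝ → ℝ :=
  pd i (if p = 0 then xt else yt)

/-- The Jacobian determinant `det T`. -/
def Jdet (xt yt : ℝ → ℝ → ℝ) : ℝ → ℝ → ℝ := fun x y =>
  Jmat xt yt 0 0 x y * Jmat xt yt 1 1 x y - Jmat xt yt 0 1 x y * Jmat xt yt 1 0 x y

/-- The pointwise inverse Jacobian matrix `S = T⁻¹`. -/
def Jinv (xt yt : ℝ → ℝ → ℝ) (k m : Fin 2) : ℝ → ℝ → ℝ := fun x y =>
  (if k = 0 then (if m = 0 then Jmat xt yt 1 1 x y else -(Jmat xt yt 0 1 x y))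
   else (if m = 0 then -(Jmat xt yt 1 0 x y) else Jmat xt yt 0 0 x y)) / Jdet xt yt x y

/-- `σ̃_i = ∂_i (det T) / det T`. -/
def sigmaT (xt yt : ℝ → ℝ → ℝ) (i : Fin 2) : ℝ → ℝ → ℝ := fun x y =>
  pd i (Jdet xt yt) x y / Jdet xt yt x y

/-- The two coefficient systems are related by the point-transformation rule (2.9). -/
def PointRelated (U : Set (ℝ × ℝ)) (xt yt P Q R S Pt Qt Rt St : ℝ → ℝ → ℝ) : Prop :=
  ∀ i j k : Fin 2, ∀ x y : ℝ, (x, y) ∈ U →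
    thetaUp P Q R S k i j x y =
      (∑ m : Fin 2, ∑ p : Fin 2, ∑ q : Fin 2,
        Jinv xt yt k m x y * Jmat xt yt p i x y * Jmat xt yt q j x y *
          thetaUp Pt Qt Rt St m p q (xt x y) (yt x y))
      + (∑ m : Fin 2, Jinv xt yt k m x y * pd j (Jmat xt yt m i) x y)
      - (sigmaT xt yt i x y * (if k = j then (1:ℝ) else 0)
          + sigmaT xt yt j x y * (if k = i then (1:ℝ) else 0)) / 3

/-- Algebraic version of `A`, in a differential ring. -/
def algA {K : Type*} [CommRing K] [Algebra ℝ K] (D₁ D₂ : Derivation ℝ K K) (p q r s : K) : K :=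
  D₂ (D₂ p) - 2 * D₁ (D₂ q) + D₁ (D₁ r) + 2 * p * D₁ s + s * D₁ p
    - 3 * p * D₂ r - 3 * r * D₂ p - 3 * q * D₁ r + 6 * q * D₂ q

/-- Algebraic version of `B`, in a differential ring. -/
def algB {K : Type*} [CommRing K] [Algebra ℝ K] (D₁ D₂ : Derivation ℝ K K) (p q r s : K) : K :=
  D₁ (D₁ s) - 2 * D₁ (D₂ r) + D₂ (D₂ q) - 2 * s * D₂ p - p * D₂ s
    + 3 * s * D₁ q + 3 * q * D₁ s + 3 * r * D₂ q - 6 * r * D₁ r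

/-- The polynomial expression of `F⁵` in terms of `A`, `B` and their derivatives. -/
def algF {K : Type*} [CommRing K] (p q r s A B Ax Ay Bx By : K) : K :=
  A * B * Ay + A * B * Bx - A ^ 2 * By - B ^ 2 * Ax - p * B ^ 3 + 3 * q * A * B ^ 2
    - 3 * r * A ^ 2 * B + s * A ^ 3

section core

variable {K K' : Type*} [CommRing K] [Algebra ℝ K] [CommRing K'] [Algebra ℝ K']

theorem core_identity (D₁ D₂ : Derivation ℝ K K) (E₁ E₂ : Derivation ℝ K' K')
    (hD : ∀ f, D₁ (D₂ f) = D₂ (D₁ f)) (hE : ∀ f, E₁ (E₂ f) = E₂ (E₁ f))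
    (pb : K' →+* K) (a b c d p q r s u v : K) (pt qt rt st : K')
    (h₁ : ∀ f, D₁ (pb f) = pb (E₁ f) * a + pb (E₂ f) * c)
    (h₂ : ∀ f, D₂ (pb f) = pb (E₁ f) * b + pb (E₂ f) * d)
    (hdet : IsUnit (a * d - b * c))
    (huv : D₁ v = D₂ u)
    (ha1 : D₁ a = a * (q + u + u) - b * p
      - (pb qt * a * a + (pb rt * a * c + pb rt * a * c) + pb st * c * c))
    (ha2 : D₂ a = a * (r + v) + b * (u - q)
      - (pb qt * a * b + (pb rt * a * d + pb rt * b * c) + pb st * c * d))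
    (hb1 : D₁ b = a * (r + v) + b * (u - q)
      - (pb qt * a * b + (pb rt * a * d + pb rt * b * c) + pb st * c * d))
    (hb2 : D₂ b = a * s + b * (v + v - r)
      - (pb qt * b * b + (pb rt * b * d + pb rt * b * d) + pb st * d * d))
    (hc1 : D₁ c = c * (q + u + u) - d * p
      + (pb pt * a * a + (pb qt * a * c + pb qt * a * c) + pb rt * c * c))
    (hc2 : D₂ c = c * (r + v) + d * (u - q)
      + (pb pt * a * b + (pb qt * a * d + pb qt * b * c) + pb rt * c * d))
    (hd1 : D₁ d = c * (r + v) + d * (u - q)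
      + (pb pt * a * b + (pb qt * a * d + pb qt * b * c) + pb rt * c * d))
    (hd2 : D₂ d = c * s + d * (v + v - r)
      + (pb pt * b * b + (pb qt * b * d + pb qt * b * d) + pb rt * d * d)) :
    algF p q r s (algA D₁ D₂ p q r s) (algB D₁ D₂ p q r s)
        (D₁ (algA D₁ D₂ p q r s)) (D₂ (algA D₁ D₂ p q r s))
        (D₁ (algB D₁ D₂ p q r s)) (D₂ (algB D₁ D₂ p q r s))
      = (a * d - b * c) ^ 5 * pb (algF pt qt rt st (algA E₁ E₂ pt qt rt st) (algB E₁ E₂ pt qt rt st)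
        (E₁ (algA E₁ E₂ pt qt rt st)) (E₂ (algA E₁ E₂ pt qt rt st))
        (E₁ (algB E₁ E₂ pt qt rt st)) (E₂ (algB E₁ E₂ pt qt rt st))) := by
  -- Ricci-type quantities
  obtain ⟨R11, hR11⟩ : ∃ z, z = D₁ q - D₂ p - (q * q + q * q) + (p * r + p * r) := ⟨_, rfl⟩
  obtain ⟨R12, hR12⟩ : ∃ z, z = D₁ r - D₂ q - q * r + p * s := ⟨_, rfl⟩
  obtain ⟨R22, hR22⟩ : ∃ z, z = D₁ s - D₂ r - (r * r + r * r) + (q * s + q * s) := ⟨_, rfl⟩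
  obtain ⟨S11, hS11⟩ : ∃ z, z = E₁ qt - E₂ pt - (qt * qt + qt * qt) + (pt * rt + pt * rt) :=
    ⟨_, rfl⟩
  obtain ⟨S12, hS12⟩ : ∃ z, z = E₁ rt - E₂ qt - qt * rt + pt * st := ⟨_, rfl⟩
  obtain ⟨S22, hS22⟩ : ∃ z, z = E₁ st - E₂ rt - (rt * rt + rt * rt) + (qt * st + qt * st) :=
    ⟨_, rfl⟩
  have pS11 := congrArg pb hS11
  have pS12 := congrArg pb hS12
  have pS22 := congrArg pb hS22
  simp only [map_add, map_sub, map_mul] at pS11 pS12 pS22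
  have ka := hD a
  have kb := hD b
  have kc := hD c
  have kd := hD d
  rw [ha1, ha2] at ka
  rw [hb1, hb2] at kb
  rw [hc1, hc2] at kc
  rw [hd1, hd2] at kd
  simp only [map_add, map_sub, Derivation.leibniz, smul_eq_mul, h₁, h₂, ha1, ha2, hb1,
    hb2, hc1, hc2, hd1, hd2, huv] at ka kb kc kd
  -- transformation of the Ricci-type quantities
  have e1 : ∀ X Y : K, a * X - b * Y = 0 → c * X - d * Y = 0 → X = 0 ∧ Y = 0 := by
    intro X Y hX hY
    constructor
    · apply hdet.mul_right_cancel
      linear_combination d * hX - b * hY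
    · apply hdet.mul_right_cancel
      linear_combination c * hX - a * hY
  have U1 := e1
    (D₂ u - (r * u - q * v + u * v + R12 - (pb S11 * a * b + (pb S12 * a * d + pb S12 * b * c) + pb S22 * c * d)))
    (D₁ u - (q * u - p * v + u * u + R11 - (pb S11 * a * a + (pb S12 * a * c + pb S12 * a * c) + pb S22 * c * c)))
    (by rw [hR11, hR12, pS11, pS12, pS22]; linear_combination -ka)
    (by rw [hR11, hR12, pS11, pS12, pS22]; linear_combination -kc)
  have U2 := e1
    (D₂ v - (s * u - r * v + v * v + R22 - (pb S11 * b * b + (pb S12 * b * d + pb S12 * b * d) + pb S22 * d * d)))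
    (D₂ u - (r * u - q * v + u * v + R12 - (pb S11 * a * b + (pb S12 * a * d + pb S12 * b * c) + pb S22 * c * d)))
    (by rw [hR22, hR12, pS11, pS12, pS22]; linear_combination -kb)
    (by rw [hR22, hR12, pS11, pS12, pS22]; linear_combination -kd)
  have Du1 := sub_eq_zero.mp U1.2
  have Du2 := sub_eq_zero.mp U1.1
  have Dv2 := sub_eq_zero.mp U2.1
  have ku := hD u
  have kv := hD v
  rw [Du1, Du2] at ku
  rw [huv, Du2, Dv2] at kv
  simp only [map_add, map_sub, Derivation.leibniz, smul_eq_mul, h₁, h₂, ha1, ha2, hb1,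
    hb2, hc1, hc2, hd1, hd2, huv, Du1, Du2, Dv2] at ku kv
  obtain ⟨A, hA⟩ : ∃ z, z = algA D₁ D₂ p q r s := ⟨_, rfl⟩
  obtain ⟨B, hB⟩ : ∃ z, z = algB D₁ D₂ p q r s := ⟨_, rfl⟩
  obtain ⟨At, hAt⟩ : ∃ z, z = algA E₁ E₂ pt qt rt st := ⟨_, rfl⟩
  obtain ⟨Bt, hBt⟩ : ∃ z, z = algB E₁ E₂ pt qt rt st := ⟨_, rfl⟩
  -- Cotton-type form of `A` and `B`
  have cA : A = D₁ R12 - D₂ R11 + r * R11 - (q * R12 + q * R12) + p * R22 := by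
    rw [hA, hR11, hR12, hR22, algA]
    simp only [map_add, map_sub, Derivation.leibniz, smul_eq_mul, hD]
    ring
  have cB : B = D₁ R22 - D₂ R12 + s * R11 - (r * R12 + r * R12) + q * R22 := by
    rw [hB, hR11, hR12, hR22, algB]
    simp only [map_add, map_sub, Derivation.leibniz, smul_eq_mul, hD]
    ring
  have cAt : At = E₁ S12 - E₂ S11 + rt * S11 - (qt * S12 + qt * S12) + pt * S22 := by
    rw [hAt, hS11, hS12, hS22, algA]
    simp only [map_add, map_sub, Derivation.leibniz, smul_eq_mul, hE]
    ring
  have cBt : Bt = E₁ S22 - E₂ S12 + st * S11 - (rt * S12 + rt * S12) + qt * S22 := by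
    rw [hBt, hS11, hS12, hS22, algB]
    simp only [map_add, map_sub, Derivation.leibniz, smul_eq_mul, hE]
    ring
  have pAt := congrArg pb cAt
  have pBt := congrArg pb cBt
  simp only [map_add, map_sub, map_mul] at pAt pBt
  have tA : A = (a * d - b * c) * (a * pb At + c * pb Bt) := by
    rw [pAt, pBt, cA]
    linear_combination ku + u * hR12 - v * hR11
  have tB : B = (a * d - b * c) * (b * pb At + d * pb Bt) := by
    rw [pAt, pBt, cB]
    linear_combination kv + u * hR22 - v * hR12
  clear pAt pBt cA cB cAt cBt ku kv ka kb kc kd U1 U2 e1 Du1 Du2 Dv2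
  obtain ⟨W, hW⟩ : ∃ z, z = a * d - b * c := ⟨_, rfl⟩
  have hW1 : D₁ W = W * (u + u + u) := by
    rw [hW]
    simp only [map_sub, Derivation.leibniz, smul_eq_mul, ha1, hb1, hc1, hd1]
    ring
  have hW2 : D₂ W = W * (v + v + v) := by
    rw [hW]
    simp only [map_sub, Derivation.leibniz, smul_eq_mul, ha2, hb2, hc2, hd2]
    ring
  rw [← hW] at tA tB
  rw [← hA, ← hB, ← hAt, ← hBt, ← hW]
  have A1 := congrArg D₁ tA
  have A2 := congrArg D₂ tA
  have B1 := congrArg D₁ tB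
  have B2 := congrArg D₂ tB
  simp only [map_add, map_sub, Derivation.leibniz, smul_eq_mul, h₁, h₂, ha1, ha2, hb1,
    hb2, hc1, hc2, hd1, hd2, hW1, hW2] at A1 A2 B1 B2
  rw [A1, A2, B1, B2, tA, tB]
  simp only [algF, map_add, map_sub, map_mul, map_pow, map_ofNat]
  have w2 : W ^ 5 = W ^ 3 * (a * d - b * c) ^ 2 := by rw [← hW]; ring
  rw [w2]
  ring

end core
section smoothAlgebra

/-- Extension by zero. -/
def extZ (U : Set (ℝ × ℝ)) (f : U → ℝ) : ℝ × ℝ → ℝ := fun z =>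
  open Classical in if h : z ∈ U then f ⟨z, h⟩ else 0

theorem extZ_mem {U : Set (ℝ × ℝ)} (f : U → ℝ) (z : U) : extZ U f z = f z := by
  simp [extZ]

/-- Smooth functions on `U`. -/
def SmAlg (U : Set (ℝ × ℝ)) : Subalgebra ℝ (U → ℝ) where
  carrier := {f | ContDiffOn ℝ (⊤ : ℕ∞) (extZ U f) U}
  mul_mem' := by
    intro f g hf hg
    refine (ContDiffOn.mul hf hg).congr ?_
    intro z hz
    simp [extZ, hz]
  add_mem' := by
    intro f g hf hg
    refine (ContDiffOn.add hf hg).congr ?_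
    intro z hz
    simp [extZ, hz]
  algebraMap_mem' := by
    intro r
    refine (contDiffOn_const (c := r)).congr ?_
    intro z hz
    simp [extZ, hz]

variable {U V : Set (ℝ × ℝ)}

/-- A function smooth on `U` as an element of the algebra. -/
def SmAlg.of (f : ℝ × ℝ → ℝ) (hf : ContDiffOn ℝ (⊤ : ℕ∞) f U) : SmAlg U :=
  ⟨fun z => f z, hf.congr (fun z hz => by simp [extZ, hz])⟩

theorem SmAlg.diffAt (hU : IsOpen U) (f : SmAlg U) (z : U) :
    DifferentiableAt ℝ (extZ U f.1) z :=
  (ContDiffOn.contDiffAt f.2 (hU.mem_nhds z.2)).differentiableAt (by simp)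

theorem SmAlg.fderiv_congr (hU : IsOpen U) {f g : ℝ × ℝ → ℝ} (h : ∀ z ∈ U, f z = g z) (z : U) :
    fderiv ℝ f z = fderiv ℝ g z := by
  apply Filter.EventuallyEq.fderiv_eq
  filter_upwards [hU.mem_nhds z.2] with w hw using h w hw

/-- Directional derivative on the algebra of smooth functions. -/
def SmAlg.D (hU : IsOpen U) (e : ℝ × ℝ) : Derivation ℝ (SmAlg U) (SmAlg U) :=
  Derivation.mk'
    { toFun := fun f => SmAlg.of (fun z => fderiv ℝ (extZ U f.1) z e)
        ((ContDiffOn.fderiv_of_isOpen f.2 hU (by simp)).clm_apply contDiffOn_const)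
      map_add' := by
        intro f g
        apply Subtype.ext
        funext z
        have h := SmAlg.fderiv_congr hU (f := extZ U (f + g).1) (g := extZ U f.1 + extZ U g.1)
          (fun z hz => by simp [extZ, hz]) z
        change fderiv ℝ (extZ U (f + g).1) z e = fderiv ℝ (extZ U f.1) z e + fderiv ℝ (extZ U g.1) z e
        rw [h, fderiv_add (SmAlg.diffAt hU f z) (SmAlg.diffAt hU g z)]
        rfl
      map_smul' := by
        intro r f
        apply Subtype.ext
        funext z
        have h := SmAlg.fderiv_congr hU (f := extZ U (r • f).1) (g := r • extZ U f.1)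
          (fun z hz => by simp [extZ, hz]) z
        change fderiv ℝ (extZ U (r • f).1) z e = r * fderiv ℝ (extZ U f.1) z e
        rw [h, fderiv_const_smul (SmAlg.diffAt hU f z)]
        rfl }
    (by
      intro f g
      apply Subtype.ext
      funext z
      have h := SmAlg.fderiv_congr hU (f := extZ U (f * g).1) (g := extZ U f.1 * extZ U g.1)
        (fun z hz => by simp [extZ, hz]) z
      change fderiv ℝ (extZ U (f * g).1) z e
        = f.1 z * fderiv ℝ (extZ U g.1) z e + g.1 z * fderiv ℝ (extZ U f.1) z e
      rw [h, fderiv_mul (SmAlg.diffAt hU f z) (SmAlg.diffAt hU g z)]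
      simp [extZ_mem])

theorem SmAlg.D_of (hU : IsOpen U) (e : ℝ × ℝ) (f : ℝ × ℝ → ℝ)
    (hf : ContDiffOn ℝ (⊤ : ℕ∞) f U) (z : U) :
    (SmAlg.D hU e (SmAlg.of f hf)).1 z = fderiv ℝ f z e := by
  change fderiv ℝ (extZ U (SmAlg.of f hf).1) z e = _
  rw [SmAlg.fderiv_congr hU (g := f) (fun z hz => by simp [extZ, hz, SmAlg.of])]

theorem SmAlg.D_comm (hU : IsOpen U) (e e' : ℝ × ℝ) (f : SmAlg U) :
    SmAlg.D hU e (SmAlg.D hU e' f) = SmAlg.D hU e' (SmAlg.D hU e f) := by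
  apply Subtype.ext
  funext z
  have hc : ContDiffAt ℝ (⊤ : ℕ∞) (extZ U f.1) z := ContDiffOn.contDiffAt f.2 (hU.mem_nhds z.2)
  have hd : DifferentiableAt ℝ (fderiv ℝ (extZ U f.1)) z :=
    (hc.fderiv_right (m := 1) (by norm_cast)).differentiableAt (by simp)
  have key : ∀ v w : ℝ × ℝ, (SmAlg.D hU v (SmAlg.D hU w f)).1 z
      = fderiv ℝ (fderiv ℝ (extZ U f.1)) z v w := by
    intro v w
    refine (SmAlg.D_of hU v (fun z => fderiv ℝ (extZ U f.1) z w)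
      ((ContDiffOn.fderiv_of_isOpen f.2 hU (by simp)).clm_apply contDiffOn_const) z).trans ?_
    rw [fderiv_clm_apply hd (by fun_prop)]
    simp
  rw [key, key]
  exact (hc.isSymmSndFDerivAt (by simp; norm_cast)).eq e e'

/-- Pullback of smooth functions. -/
def SmAlg.pull (φ : ℝ × ℝ → ℝ × ℝ) (hφ : ContDiffOn ℝ (⊤ : ℕ∞) φ U) (hm : Set.MapsTo φ U V) :
    SmAlg V →+* SmAlg U where
  toFun f := ⟨fun z => f.1 ⟨φ z, hm z.2⟩, (ContDiffOn.comp f.2 hφ hm).congr (fun z hz => by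
    simp [extZ, hz, hm hz])⟩
  map_one' := rfl
  map_mul' _ _ := rfl
  map_zero' := rfl
  map_add' _ _ := rfl

theorem SmAlg.D_pull (hU : IsOpen U) (hV : IsOpen V) (φ : ℝ × ℝ → ℝ × ℝ)
    (hφ : ContDiffOn ℝ (⊤ : ℕ∞) φ U) (hm : Set.MapsTo φ U V) (e : ℝ × ℝ) (f : SmAlg V) :
    SmAlg.D hU e (SmAlg.pull φ hφ hm f)
      = SmAlg.pull φ hφ hm (SmAlg.D hV (1, 0) f) * SmAlg.D hU e (SmAlg.of (fun z => (φ z).1) hφ.fst)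
      + SmAlg.pull φ hφ hm (SmAlg.D hV (0, 1) f)
        * SmAlg.D hU e (SmAlg.of (fun z => (φ z).2) hφ.snd) := by
  apply Subtype.ext
  funext z
  have hd : DifferentiableAt ℝ φ z :=
    (hφ.contDiffAt (hU.mem_nhds z.2)).differentiableAt (by simp)
  have hf : DifferentiableAt ℝ (extZ V f.1) (φ z) := SmAlg.diffAt hV f ⟨φ z, hm z.2⟩
  have h := SmAlg.fderiv_congr hU (f := extZ U (SmAlg.pull φ hφ hm f).1) (g := extZ V f.1 ∘ φ)
      (fun z hz => by simp [extZ, hz, hm hz, SmAlg.pull]) z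
  change fderiv ℝ (extZ U (SmAlg.pull φ hφ hm f).1) z e
    = fderiv ℝ (extZ V f.1) (φ z) (1, 0) * (SmAlg.D hU e (SmAlg.of (fun z => (φ z).1) hφ.fst)).1 z
    + fderiv ℝ (extZ V f.1) (φ z) (0, 1) * (SmAlg.D hU e (SmAlg.of (fun z => (φ z).2) hφ.snd)).1 z
  rw [SmAlg.D_of, SmAlg.D_of, h, fderiv_comp _ hf hd, fderiv.fst hd, fderiv.snd hd]
  have hv : ∀ w : ℝ × ℝ, fderiv ℝ (extZ V f.1) (φ z) w
      = fderiv ℝ (extZ V f.1) (φ z) (1, 0) * w.1 + fderiv ℝ (extZ V f.1) (φ z) (0, 1) * w.2 := by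
    intro w
    have : w = w.1 • ((1, 0) : ℝ × ℝ) + w.2 • ((0, 1) : ℝ × ℝ) := by ext <;> simp
    conv_lhs => rw [this, map_add, map_smul, map_smul]
    simp [mul_comm]
  exact hv _

end smoothAlgebra
section bridge

variable {U V : Set (ℝ × ℝ)}

/-- Evaluation at a point. -/
def SmAlg.ev (z : U) : SmAlg U →+* ℝ where
  toFun f := f.1 z
  map_one' := rfl
  map_mul' _ _ := rfl
  map_zero' := rfl
  map_add' _ _ := rfl

theorem SmAlg.ev_ext {f g : SmAlg U} (h : ∀ z, SmAlg.ev z f = SmAlg.ev z g) : f = g :=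
  Subtype.ext (funext h)

theorem SmAlg.ev_smul (r : ℝ) (f : SmAlg U) (z : U) : SmAlg.ev z (r • f) = r * SmAlg.ev z f := rfl

theorem SmAlg.exists_inv (k : SmAlg U) (h : ∀ z, SmAlg.ev z k ≠ 0) : ∃ k', k * k' = 1 := by
  refine ⟨SmAlg.of (fun z => (extZ U k.1 z)⁻¹) (ContDiffOn.inv k.2 ?_), ?_⟩
  · intro z hz
    have := h ⟨z, hz⟩
    rwa [show extZ U k.1 z = k.1 ⟨z, hz⟩ from extZ_mem k.1 ⟨z, hz⟩]
  · apply SmAlg.ev_ext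
    intro z
    change k.1 z * (extZ U k.1 z)⁻¹ = 1
    rw [extZ_mem]
    exact mul_inv_cancel₀ (h z)

/-- The algebra element `k` represents the function `f` on `U`. -/
def RepOn (f : ℝ → ℝ → ℝ) (k : SmAlg U) : Prop := ∀ z : U, f z.1.1 z.1.2 = SmAlg.ev z k

theorem Smooth2.rep {f : ℝ → ℝ → ℝ} (hf : Smooth2 U f) :
    RepOn f (SmAlg.of (Function.uncurry f) hf) := fun _ => rfl

theorem RepOn.pdx (hU : IsOpen U) {f : ℝ → ℝ → ℝ} {k : SmAlg U} (h : RepOn f k) :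
    RepOn (pdx f) (SmAlg.D hU (1, 0) k) := by
  rintro ⟨⟨x, y⟩, hz⟩
  have hd := (SmAlg.diffAt hU k ⟨(x, y), hz⟩).hasFDerivAt
  have hc : HasDerivAt (fun t : ℝ => (t, y)) ((1 : ℝ), (0 : ℝ)) x :=
    (hasDerivAt_id x).prodMk (hasDerivAt_const x y)
  have h1 := hd.comp_hasDerivAt x hc
  change deriv (fun t => f t y) x = fderiv ℝ (extZ U k.1) (x, y) (1, 0)
  rw [← h1.deriv]
  apply Filter.EventuallyEq.deriv_eq
  have := hc.continuousAt.preimage_mem_nhds (hU.mem_nhds hz)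
  filter_upwards [this] with t ht
  exact (h ⟨(t, y), ht⟩).trans (extZ_mem k.1 ⟨(t, y), ht⟩).symm

theorem RepOn.pdy (hU : IsOpen U) {f : ℝ → ℝ → ℝ} {k : SmAlg U} (h : RepOn f k) :
    RepOn (pdy f) (SmAlg.D hU (0, 1) k) := by
  rintro ⟨⟨x, y⟩, hz⟩
  have hd := (SmAlg.diffAt hU k ⟨(x, y), hz⟩).hasFDerivAt
  have hc : HasDerivAt (fun t : ℝ => (x, t)) ((0 : ℝ), (1 : ℝ)) y :=
    (hasDerivAt_const y x).prodMk (hasDerivAt_id y)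
  have h1 := hd.comp_hasDerivAt y hc
  change deriv (fun t => f x t) y = fderiv ℝ (extZ U k.1) (x, y) (0, 1)
  rw [← h1.deriv]
  apply Filter.EventuallyEq.deriv_eq
  have := hc.continuousAt.preimage_mem_nhds (hU.mem_nhds hz)
  filter_upwards [this] with t ht
  exact (h ⟨(x, t), ht⟩).trans (extZ_mem k.1 ⟨(x, t), ht⟩).symm

theorem RepOn.coefA (hU : IsOpen U) {P Q R S : ℝ → ℝ → ℝ} {p q r s : SmAlg U}
    (hp : RepOn P p) (hq : RepOn Q q) (hr : RepOn R r) (hs : RepOn S s) :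
    RepOn (coefA P Q R S) (algA (SmAlg.D hU (1, 0)) (SmAlg.D hU (0, 1)) p q r s) := by
  intro z
  simp only [_root_.coefA, algA, map_add, map_sub, map_mul, map_ofNat, hp z, hq z, hr z, hs z,
    hp.pdx hU z, hp.pdy hU z, (hp.pdy hU).pdy hU z, (hq.pdy hU).pdx hU z, (hr.pdx hU).pdx hU z,
    hs.pdx hU z, hr.pdy hU z, hr.pdx hU z, hq.pdy hU z]

theorem RepOn.coefB (hU : IsOpen U) {P Q R S : ℝ → ℝ → ℝ} {p q r s : SmAlg U}
    (hp : RepOn P p) (hq : RepOn Q q) (hr : RepOn R r) (hs : RepOn S s) :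
    RepOn (coefB P Q R S) (algB (SmAlg.D hU (1, 0)) (SmAlg.D hU (0, 1)) p q r s) := by
  intro z
  simp only [_root_.coefB, algB, map_add, map_sub, map_mul, map_ofNat, hp z, hq z, hr z, hs z,
    hp.pdy hU z, (hs.pdx hU).pdx hU z, (hr.pdy hU).pdx hU z, (hq.pdy hU).pdy hU z,
    hs.pdy hU z, hs.pdx hU z, hr.pdx hU z, hq.pdx hU z, hq.pdy hU z]

theorem RepOn.coefF5 (hU : IsOpen U) {P Q R S : ℝ → ℝ → ℝ} {p q r s : SmAlg U}
    (hp : RepOn P p) (hq : RepOn Q q) (hr : RepOn R r) (hs : RepOn S s) :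
    RepOn (coefF5 P Q R S) (algF p q r s
      (algA (SmAlg.D hU (1, 0)) (SmAlg.D hU (0, 1)) p q r s)
      (algB (SmAlg.D hU (1, 0)) (SmAlg.D hU (0, 1)) p q r s)
      (SmAlg.D hU (1, 0) (algA (SmAlg.D hU (1, 0)) (SmAlg.D hU (0, 1)) p q r s))
      (SmAlg.D hU (0, 1) (algA (SmAlg.D hU (1, 0)) (SmAlg.D hU (0, 1)) p q r s))
      (SmAlg.D hU (1, 0) (algB (SmAlg.D hU (1, 0)) (SmAlg.D hU (0, 1)) p q r s))
      (SmAlg.D hU (0, 1) (algB (SmAlg.D hU (1, 0)) (SmAlg.D hU (0, 1)) p q r s))) := by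
  intro z
  have hA := RepOn.coefA hU hp hq hr hs
  have hB := RepOn.coefB hU hp hq hr hs
  simp only [_root_.coefF5, algF, map_add, map_sub, map_mul, map_pow, map_ofNat, hp z, hq z, hr z,
    hs z, hA z, hB z, hA.pdx hU z, hA.pdy hU z, hB.pdx hU z, hB.pdy hU z]

/-- Solving the point-transformation rule for the second derivatives. -/
theorem solve_rule {a b c d W Z₁ Z₂ t₀ t₁ s₀ s₁ : ℝ} (hW : W = a * d - b * c) (h0 : W ≠ 0)
    (e₀ : t₀ = d / W * Z₁ + -b / W * Z₂ - s₀) (e₁ : t₁ = -c / W * Z₁ + a / W * Z₂ - s₁) :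
    a * (t₀ + s₀) + b * (t₁ + s₁) = Z₁ ∧ c * (t₀ + s₀) + d * (t₁ + s₁) = Z₂ := by
  rw [e₀, e₁]
  constructor
  · field_simp
    rw [hW]
    ring
  · field_simp
    rw [hW]
    ring

end bridge

set_option linter.unusedSimpArgs false in
set_option maxHeartbeats 4000000 in
/-- Theorem 2.1: `F⁵` is pseudoscalar of weight 5, i.e. formula (2.2) defines the
pseudoscalar field `F` of weight 1 in arbitrary coordinates. -/
theorem F5_pseudoscalar_weight_five
    (U Ut : Set (ℝ × ℝ)) (hU : IsOpen U) (hUconn : IsConnected U) (hUt : IsOpen Ut)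
    (xt yt : ℝ → ℝ → ℝ) (hxt : Smooth2 U xt) (hyt : Smooth2 U yt)
    (hmaps : ∀ x y : ℝ, (x, y) ∈ U → (xt x y, yt x y) ∈ Ut)
    (hdet : ∀ x y : ℝ, (x, y) ∈ U → Jdet xt yt x y ≠ 0)
    (P Q R S Pt Qt Rt St : ℝ → ℝ → ℝ)
    (hP : Smooth2 U P) (hQ : Smooth2 U Q) (hR : Smooth2 U R) (hS : Smooth2 U S)
    (hPt : Smooth2 Ut Pt) (hQt : Smooth2 Ut Qt) (hRt : Smooth2 Ut Rt) (hSt : Smooth2 Ut St)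
    (hrel : PointRelated U xt yt P Q R S Pt Qt Rt St) :
    ∀ x y : ℝ, (x, y) ∈ U →
      coefF5 P Q R S x y =
        (Jdet xt yt x y)^5 * coefF5 Pt Qt Rt St (xt x y) (yt x y) := by
  have hφ : ContDiffOn ℝ (⊤ : ℕ∞) (fun z : ℝ × ℝ => (xt z.1 z.2, yt z.1 z.2)) U :=
    ContDiffOn.prodMk hxt hyt
  have hm : Set.MapsTo (fun z : ℝ × ℝ => (xt z.1 z.2, yt z.1 z.2)) U Ut :=
    fun z hz => hmaps z.1 z.2 hz
  obtain ⟨D₁, hD₁⟩ : ∃ z, z = SmAlg.D hU (1, 0) := ⟨_, rfl⟩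
  obtain ⟨D₂, hD₂⟩ : ∃ z, z = SmAlg.D hU (0, 1) := ⟨_, rfl⟩
  obtain ⟨pb, hpb⟩ : ∃ z, z = SmAlg.pull _ hφ hm := ⟨_, rfl⟩
  have rP := hP.rep
  have rQ := hQ.rep
  have rR := hR.rep
  have rS := hS.rep
  have rPt := hPt.rep
  have rQt := hQt.rep
  have rRt := hRt.rep
  have rSt := hSt.rep
  have rX := hxt.rep
  have rY := hyt.rep
  have hF := RepOn.coefF5 hU rP rQ rR rS
  have hFt := RepOn.coefF5 hUt rPt rQt rRt rSt
  have ra := rX.pdx hU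
  have rb := rX.pdy hU
  have rc := rY.pdx hU
  have rd := rY.pdy hU
  have h₁ := SmAlg.D_pull hU hUt _ hφ hm (1, 0)
  have h₂ := SmAlg.D_pull hU hUt _ hφ hm (0, 1)
  change ∀ f, _ = _ * SmAlg.D hU (1, 0) (SmAlg.of (Function.uncurry xt) hxt)
    + _ * SmAlg.D hU (1, 0) (SmAlg.of (Function.uncurry yt) hyt) at h₁
  change ∀ f, _ = _ * SmAlg.D hU (0, 1) (SmAlg.of (Function.uncurry xt) hxt)
    + _ * SmAlg.D hU (0, 1) (SmAlg.of (Function.uncurry yt) hyt) at h₂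
  have hpull : ∀ {f : ℝ → ℝ → ℝ} {k : SmAlg Ut}, RepOn f k →
      RepOn (fun x y => f (xt x y) (yt x y)) (pb k) := by
    intro f k hf z
    rw [hpb]
    exact hf ⟨_, hm z.2⟩
  have ra1 := ra.pdx hU
  have ra2 := ra.pdy hU
  have rb1 := rb.pdx hU
  have rb2 := rb.pdy hU
  have rc1 := rc.pdx hU
  have rc2 := rc.pdy hU
  have rd1 := rd.pdx hU
  have rd2 := rd.pdy hU
  have hD : ∀ f, D₁ (D₂ f) = D₂ (D₁ f) := by rw [hD₁, hD₂]; exact SmAlg.D_comm hU _ _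
  generalize SmAlg.of (Function.uncurry P) hP = p at *
  generalize SmAlg.of (Function.uncurry Q) hQ = q at *
  generalize SmAlg.of (Function.uncurry R) hR = r at *
  generalize SmAlg.of (Function.uncurry S) hS = s at *
  generalize SmAlg.of (Function.uncurry Pt) hPt = pt at *
  generalize SmAlg.of (Function.uncurry Qt) hQt = qt at *
  generalize SmAlg.of (Function.uncurry Rt) hRt = rt at *
  generalize SmAlg.of (Function.uncurry St) hSt = st at *
  rw [← hD₁] at hF ra rc h₁ ra1 rb1 rc1 rd1
  rw [← hD₂] at hF rb rd h₂ ra2 rb2 rc2 rd2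
  rw [← hD₁] at ra2 rc2
  rw [← hD₂] at rb1 rd1
  rw [← hpb] at h₁ h₂
  generalize D₁ (SmAlg.of (Function.uncurry xt) hxt) = a at *
  generalize D₂ (SmAlg.of (Function.uncurry xt) hxt) = b at *
  generalize D₁ (SmAlg.of (Function.uncurry yt) hyt) = c at *
  generalize D₂ (SmAlg.of (Function.uncurry yt) hyt) = d at *
  have rW : RepOn (Jdet xt yt) (a * d - b * c) := by
    intro z
    simp [Jdet, Jmat, pd, ra z, rb z, rc z, rd z]
  have hW0 : ∀ z, SmAlg.ev z (a * d - b * c) ≠ 0 := fun z => by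
    rw [← rW z]; exact hdet _ _ z.2
  obtain ⟨W', hW'⟩ := SmAlg.exists_inv _ hW0
  have rW1 := rW.pdx hU
  have rW2 := rW.pdy hU
  rw [← hD₁] at rW1
  rw [← hD₂] at rW2
  obtain ⟨W, hWdef⟩ : ∃ z, z = a * d - b * c := ⟨_, rfl⟩
  rw [← hWdef] at rW hW0 hW' rW1 rW2
  obtain ⟨u, hu⟩ : ∃ z, z = (1 / 3 : ℝ) • (D₁ W * W') := ⟨_, rfl⟩
  obtain ⟨v, hv⟩ : ∃ z, z = (1 / 3 : ℝ) • (D₂ W * W') := ⟨_, rfl⟩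
  have huv : D₁ v = D₂ u := by
    have k1 := congrArg D₁ hW'
    have k2 := congrArg D₂ hW'
    simp only [Derivation.leibniz, smul_eq_mul, Derivation.map_one_eq_zero] at k1 k2
    rw [hu, hv, Derivation.map_smul, Derivation.map_smul]
    congr 1
    simp only [Derivation.leibniz, smul_eq_mul, hD]
    linear_combination (-(D₂ W * D₁ W') + D₁ W * D₂ W') * hW' + D₂ W * W' * k1 - D₁ W * W' * k2
  have hW'' : ∀ z, SmAlg.ev z W' = (SmAlg.ev z W)⁻¹ := by
    intro z
    have := congrArg (SmAlg.ev z) hW'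
    rw [map_mul, map_one] at this
    exact eq_inv_of_mul_eq_one_right this
  have su : ∀ z : U, sigmaT xt yt 0 z.1.1 z.1.2 = 3 * SmAlg.ev z u := by
    intro z
    rw [hu, SmAlg.ev_smul, map_mul, hW'', ← rW z, ← rW1 z]
    simp only [sigmaT, pd, if_true]
    ring
  have sv : ∀ z : U, sigmaT xt yt 1 z.1.1 z.1.2 = 3 * SmAlg.ev z v := by
    intro z
    rw [hv, SmAlg.ev_smul, map_mul, hW'', ← rW z, ← rW2 z]
    simp [sigmaT, pd]
    ring
  have eW : ∀ z, SmAlg.ev z W = SmAlg.ev z a * SmAlg.ev z d - SmAlg.ev z b * SmAlg.ev z c := by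
    intro z
    rw [hWdef]; simp
  have k00 : ∀ z : U, _ := fun z => by
    have e0 := hrel 0 0 0 z.1.1 z.1.2 z.2
    have e1 := hrel 0 0 1 z.1.1 z.1.2 z.2
    simp [Fin.sum_univ_two, thetaUp, thetaLow, Jinv, Jmat, pd, ra z, rb z, rc z, rd z, rW z,
      su z, sv z, rP z, rQ z, rR z, rS z, hpull rPt z, hpull rQt z, hpull rRt z, hpull rSt z,
      ra1 z, ra2 z, rb1 z, rb2 z, rc1 z, rc2 z, rd1 z, rd2 z] at e0 e1
    exact solve_rule (eW z) (hW0 z)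
      (Z₁ := (SmAlg.ev z (pb qt) * SmAlg.ev z a * SmAlg.ev z a + SmAlg.ev z (pb rt) * SmAlg.ev z a * SmAlg.ev z c
        + SmAlg.ev z (pb rt) * SmAlg.ev z c * SmAlg.ev z a + SmAlg.ev z (pb st) * SmAlg.ev z c * SmAlg.ev z c)
        + SmAlg.ev z (D₁ a))
      (Z₂ := -(SmAlg.ev z (pb pt) * SmAlg.ev z a * SmAlg.ev z a + SmAlg.ev z (pb qt) * SmAlg.ev z a * SmAlg.ev z c
        + SmAlg.ev z (pb qt) * SmAlg.ev z c * SmAlg.ev z a + SmAlg.ev z (pb rt) * SmAlg.ev z c * SmAlg.ev z c)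
        + SmAlg.ev z (D₁ c))
      (t₀ := SmAlg.ev z q) (t₁ := -SmAlg.ev z p)
      (s₀ := SmAlg.ev z u + SmAlg.ev z u) (s₁ := 0)
      (by linear_combination e0) (by linear_combination e1)
  have k01 : ∀ z : U, _ := fun z => by
    have e0 := hrel 0 1 0 z.1.1 z.1.2 z.2
    have e1 := hrel 0 1 1 z.1.1 z.1.2 z.2
    simp [Fin.sum_univ_two, thetaUp, thetaLow, Jinv, Jmat, pd, ra z, rb z, rc z, rd z, rW z,
      su z, sv z, rP z, rQ z, rR z, rS z, hpull rPt z, hpull rQt z, hpull rRt z, hpull rSt z,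
      ra1 z, ra2 z, rb1 z, rb2 z, rc1 z, rc2 z, rd1 z, rd2 z] at e0 e1
    exact solve_rule (eW z) (hW0 z)
      (Z₁ := (SmAlg.ev z (pb qt) * SmAlg.ev z a * SmAlg.ev z b + SmAlg.ev z (pb rt) * SmAlg.ev z a * SmAlg.ev z d
        + SmAlg.ev z (pb rt) * SmAlg.ev z c * SmAlg.ev z b + SmAlg.ev z (pb st) * SmAlg.ev z c * SmAlg.ev z d)
        + SmAlg.ev z (D₂ a))
      (Z₂ := -(SmAlg.ev z (pb pt) * SmAlg.ev z a * SmAlg.ev z b + SmAlg.ev z (pb qt) * SmAlg.ev z a * SmAlg.ev z d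
        + SmAlg.ev z (pb qt) * SmAlg.ev z c * SmAlg.ev z b + SmAlg.ev z (pb rt) * SmAlg.ev z c * SmAlg.ev z d)
        + SmAlg.ev z (D₂ c))
      (t₀ := SmAlg.ev z r) (t₁ := -SmAlg.ev z q)
      (s₀ := SmAlg.ev z v) (s₁ := SmAlg.ev z u)
      (by linear_combination e0) (by linear_combination e1)
  have k10 : ∀ z : U, _ := fun z => by
    have e0 := hrel 1 0 0 z.1.1 z.1.2 z.2
    have e1 := hrel 1 0 1 z.1.1 z.1.2 z.2
    simp [Fin.sum_univ_two, thetaUp, thetaLow, Jinv, Jmat, pd, ra z, rb z, rc z, rd z, rW z,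
      su z, sv z, rP z, rQ z, rR z, rS z, hpull rPt z, hpull rQt z, hpull rRt z, hpull rSt z,
      ra1 z, ra2 z, rb1 z, rb2 z, rc1 z, rc2 z, rd1 z, rd2 z] at e0 e1
    exact solve_rule (eW z) (hW0 z)
      (Z₁ := (SmAlg.ev z (pb qt) * SmAlg.ev z b * SmAlg.ev z a + SmAlg.ev z (pb rt) * SmAlg.ev z b * SmAlg.ev z c
        + SmAlg.ev z (pb rt) * SmAlg.ev z d * SmAlg.ev z a + SmAlg.ev z (pb st) * SmAlg.ev z d * SmAlg.ev z c)
        + SmAlg.ev z (D₁ b))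
      (Z₂ := -(SmAlg.ev z (pb pt) * SmAlg.ev z b * SmAlg.ev z a + SmAlg.ev z (pb qt) * SmAlg.ev z b * SmAlg.ev z c
        + SmAlg.ev z (pb qt) * SmAlg.ev z d * SmAlg.ev z a + SmAlg.ev z (pb rt) * SmAlg.ev z d * SmAlg.ev z c)
        + SmAlg.ev z (D₁ d))
      (t₀ := SmAlg.ev z r) (t₁ := -SmAlg.ev z q)
      (s₀ := SmAlg.ev z v) (s₁ := SmAlg.ev z u)
      (by linear_combination e0) (by linear_combination e1)
  have k11 : ∀ z : U, _ := fun z => by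
    have e0 := hrel 1 1 0 z.1.1 z.1.2 z.2
    have e1 := hrel 1 1 1 z.1.1 z.1.2 z.2
    simp [Fin.sum_univ_two, thetaUp, thetaLow, Jinv, Jmat, pd, ra z, rb z, rc z, rd z, rW z,
      su z, sv z, rP z, rQ z, rR z, rS z, hpull rPt z, hpull rQt z, hpull rRt z, hpull rSt z,
      ra1 z, ra2 z, rb1 z, rb2 z, rc1 z, rc2 z, rd1 z, rd2 z] at e0 e1
    exact solve_rule (eW z) (hW0 z)
      (Z₁ := (SmAlg.ev z (pb qt) * SmAlg.ev z b * SmAlg.ev z b + SmAlg.ev z (pb rt) * SmAlg.ev z b * SmAlg.ev z d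
        + SmAlg.ev z (pb rt) * SmAlg.ev z d * SmAlg.ev z b + SmAlg.ev z (pb st) * SmAlg.ev z d * SmAlg.ev z d)
        + SmAlg.ev z (D₂ b))
      (Z₂ := -(SmAlg.ev z (pb pt) * SmAlg.ev z b * SmAlg.ev z b + SmAlg.ev z (pb qt) * SmAlg.ev z b * SmAlg.ev z d
        + SmAlg.ev z (pb qt) * SmAlg.ev z d * SmAlg.ev z b + SmAlg.ev z (pb rt) * SmAlg.ev z d * SmAlg.ev z d)
        + SmAlg.ev z (D₂ d))
      (t₀ := SmAlg.ev z s) (t₁ := -SmAlg.ev z r)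
      (s₀ := 0) (s₁ := SmAlg.ev z v + SmAlg.ev z v)
      (by linear_combination e0) (by linear_combination e1)
  have main := core_identity D₁ D₂ (SmAlg.D hUt (1, 0)) (SmAlg.D hUt (0, 1)) hD
    (SmAlg.D_comm hUt _ _) pb a b c d p q r s u v pt qt rt st h₁ h₂
    (by rw [← hWdef]; exact IsUnit.of_mul_eq_one _ hW') huv
    (by
      apply SmAlg.ev_ext
      intro z
      simp only [map_add, map_sub, map_mul]
      linear_combination -(k00 z).1)
    (by
      apply SmAlg.ev_ext
      intro z
      simp only [map_add, map_sub, map_mul]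
      linear_combination -(k01 z).1)
    (by
      apply SmAlg.ev_ext
      intro z
      simp only [map_add, map_sub, map_mul]
      linear_combination -(k10 z).1)
    (by
      apply SmAlg.ev_ext
      intro z
      simp only [map_add, map_sub, map_mul]
      linear_combination -(k11 z).1)
    (by
      apply SmAlg.ev_ext
      intro z
      simp only [map_add, map_sub, map_mul]
      linear_combination -(k00 z).2)
    (by
      apply SmAlg.ev_ext
      intro z
      simp only [map_add, map_sub, map_mul]
      linear_combination -(k01 z).2)
    (by
      apply SmAlg.ev_ext
      intro z
      simp only [map_add, map_sub, map_mul]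
      linear_combination -(k10 z).2)
    (by
      apply SmAlg.ev_ext
      intro z
      simp only [map_add, map_sub, map_mul]
      linear_combination -(k11 z).2)
  intro x y hz
  have h5 := congrArg (SmAlg.ev ⟨(x, y), hz⟩) main
  rw [← hF ⟨(x, y), hz⟩, map_mul, map_pow, ← hWdef, ← rW ⟨(x, y), hz⟩,
    ← hpull hFt ⟨(x, y), hz⟩] at h5
  exact h5
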